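/- arXiv:2001.08054 — 2 statements merged into one kernel-verified Lean document; each statement's English description precedes it below -/
import Mathlib

section
/- For every 3-periodic billiard orbit P₁P₂P₃ in the ellipse E, the ratio of the orbit's area A to the area A' of its excentral triangle is the same and equals A/A' = (δ − b²)(a² − δ)/(a² − b²)² (that is, A/A' = r/(2R)). -/
noncomputable section

open EuclideanGeometry Real

/-- Points of the plane. -/
abbrev Pt := EuclideanSpace ℝ (Fin 2)

/-- Membership in the billiard ellipse `x²/a² + y²/b² = 1`. -/
def onEllipse (a b : ℝ) (P : Pt) : Prop :=
  (P 0) ^ 2 / a ^ 2 + (P 1) ^ 2 / b ^ 2 = 1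

/-- Billiard reflection law at vertex `P` (other vertices `Q`, `R`): the sum of the two
unit vectors from `P` towards `Q` and `R` is orthogonal to the tangent direction
`(-P.y/b², P.x/a²)` of the ellipse at `P`. -/
def reflects (a b : ℝ) (P Q R : Pt) : Prop :=
  (‖Q - P‖⁻¹ • (Q - P) + ‖R - P‖⁻¹ • (R - P)) 0 * (-(P 1) / b ^ 2) +
  (‖Q - P‖⁻¹ • (Q - P) + ‖R - P‖⁻¹ • (R - P)) 1 * ((P 0) / a ^ 2) = 0

/-- `P₁P₂P₃` is a 3-periodic billiard orbit in the ellipse with semiaxes `a`, `b`: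
pairwise distinct points on the ellipse satisfying the reflection law at every vertex. -/
def IsOrbit (a b : ℝ) (P₁ P₂ P₃ : Pt) : Prop :=
  P₁ ≠ P₂ ∧ P₂ ≠ P₃ ∧ P₁ ≠ P₃ ∧
  onEllipse a b P₁ ∧ onEllipse a b P₂ ∧ onEllipse a b P₃ ∧
  reflects a b P₁ P₂ P₃ ∧ reflects a b P₂ P₃ P₁ ∧ reflects a b P₃ P₁ P₂

lemma aux_refl (n0 n1 q0 q1 r0 r1 s t : ℝ) (hs : 0 < s) (ht : 0 < t)
    (hs2 : s ^ 2 = q0 ^ 2 + q1 ^ 2) (ht2 : t ^ 2 = r0 ^ 2 + r1 ^ 2)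
    (h : (s⁻¹ * q0 + t⁻¹ * r0) * (-n1) + (s⁻¹ * q1 + t⁻¹ * r1) * n0 = 0)
    (hq : n0 * q0 + n1 * q1 < 0) (hr : n0 * r0 + n1 * r1 < 0) :
    (n0 * q0 + n1 * q1) * t = (n0 * r0 + n1 * r1) * s := by
  have h1 : t * (n0 * q1 - n1 * q0) = - (s * (n0 * r1 - n1 * r0)) := by
    field_simp at h
    linarith
  have h2 : ((n0 * q0 + n1 * q1) * t) ^ 2 = ((n0 * r0 + n1 * r1) * s) ^ 2 := by
    have h3 : (t * (n0 * q1 - n1 * q0)) ^ 2 = (s * (n0 * r1 - n1 * r0)) ^ 2 := by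
      rw [h1]; ring
    linear_combination (-1) * h3 - (n0 ^ 2 + n1 ^ 2) * t ^ 2 * hs2
      + (n0 ^ 2 + n1 ^ 2) * s ^ 2 * ht2
  rcases sq_eq_sq_iff_eq_or_eq_neg.mp h2 with h3 | h3
  · exact h3
  · nlinarith [mul_pos (neg_pos.mpr hq) ht, mul_pos (neg_pos.mpr hr) hs]

lemma aux_cplx (z1 z2 z3 w1 w2 w3 A K c : ℂ) (h1 : z1 * w1 = 1) (h2 : z2 * w2 = 1)
    (h3 : z3 * w3 = 1) (d12 : z1 ≠ z2) (d13 : z1 ≠ z3) (d23 : z2 ≠ z3)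
    (f12 : 2 * A + K * (z1 * w2 + z2 * w1) - c * (z1 * z2 + w1 * w2) = 0)
    (f13 : 2 * A + K * (z1 * w3 + z3 * w1) - c * (z1 * z3 + w1 * w3) = 0)
    (f23 : 2 * A + K * (z2 * w3 + z3 * w2) - c * (z2 * z3 + w2 * w3) = 0) :
    K * (z1 + z2 + z3) = - c * (z1 * z2 * z3) ∧
    c * (z1 * z2 + z1 * z3 + z2 * z3) = 2 * A - K := by
  have key : ∀ x y p q : ℂ, x * p = 1 → y * q = 1 →
      2 * A + K * (x * q + y * p) - c * (x * y + p * q) = 0 →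
      2 * A * (x * y) + K * (x ^ 2 + y ^ 2) - c * (x ^ 2 * y ^ 2 + 1) = 0 := by
    intro x y p q hx hy h
    linear_combination (x * y) * h - K * x ^ 2 * hy - K * y ^ 2 * hx
      + c * (y * q) * hx + c * hy
  have F12 := key _ _ _ _ h1 h2 f12
  have F13 := key _ _ _ _ h1 h3 f13
  have F23 := key _ _ _ _ h2 h3 f23
  have G1 : 2 * A * z1 + K * (z2 + z3) - c * z1 ^ 2 * (z2 + z3) = 0 := by
    apply mul_left_cancel₀ (sub_ne_zero.mpr d23)
    linear_combination F12 - F13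
  have G2 : 2 * A * z2 + K * (z1 + z3) - c * z2 ^ 2 * (z1 + z3) = 0 := by
    apply mul_left_cancel₀ (sub_ne_zero.mpr d13)
    linear_combination F12 - F23
  have H : c * (z1 * z2 + z1 * z3 + z2 * z3) = 2 * A - K := by
    apply mul_left_cancel₀ (sub_ne_zero.mpr d12)
    linear_combination G2 - G1
  refine ⟨?_, H⟩
  linear_combination G1 + z1 * H

lemma aux_core (u1 v1 u2 v2 u3 v3 A K c : ℝ) (h1 : u1 ^ 2 + v1 ^ 2 = 1)
    (h2 : u2 ^ 2 + v2 ^ 2 = 1) (h3 : u3 ^ 2 + v3 ^ 2 = 1)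
    (d12 : ¬ (u1 = u2 ∧ v1 = v2)) (d13 : ¬ (u1 = u3 ∧ v1 = v3)) (d23 : ¬ (u2 = u3 ∧ v2 = v3))
    (f12 : A + K * (u1 * u2 + v1 * v2) - c * (u1 * u2 - v1 * v2) = 0)
    (f13 : A + K * (u1 * u3 + v1 * v3) - c * (u1 * u3 - v1 * v3) = 0)
    (f23 : A + K * (u2 * u3 + v2 * v3) - c * (u2 * u3 - v2 * v3) = 0) :
    K ^ 2 * ((u1 + u2 + u3) ^ 2 + (v1 + v2 + v3) ^ 2) = c ^ 2 ∧
    K * (2 * A - K) = - c ^ 2 := by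
  have hz : ∀ u v : ℝ, u ^ 2 + v ^ 2 = 1 → (⟨u, v⟩ : ℂ) * ⟨u, -v⟩ = 1 := by
    intro u v h
    apply Complex.ext <;> simp <;> linarith
  have hf : ∀ u v x y : ℝ, A + K * (u * x + v * y) - c * (u * x - v * y) = 0 →
      2 * (A : ℂ) + K * ((⟨u, v⟩ : ℂ) * ⟨x, -y⟩ + ⟨x, y⟩ * ⟨u, -v⟩)
       - c * ((⟨u, v⟩ : ℂ) * ⟨x, y⟩ + ⟨u, -v⟩ * ⟨x, -y⟩) = 0 := by
    intro u v x y h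
    apply Complex.ext <;> simp <;> linarith
  have hd : ∀ u v x y : ℝ, ¬ (u = x ∧ v = y) → (⟨u, v⟩ : ℂ) ≠ ⟨x, y⟩ := by
    intro u v x y h h'
    exact h ⟨congrArg Complex.re h', congrArg Complex.im h'⟩
  obtain ⟨X, Y⟩ := aux_cplx ⟨u1, v1⟩ ⟨u2, v2⟩ ⟨u3, v3⟩ ⟨u1, -v1⟩ ⟨u2, -v2⟩ ⟨u3, -v3⟩ A K c
    (hz _ _ h1) (hz _ _ h2) (hz _ _ h3) (hd _ _ _ _ d12) (hd _ _ _ _ d13) (hd _ _ _ _ d23)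
    (hf _ _ _ _ f12) (hf _ _ _ _ f13) (hf _ _ _ _ f23)
  have Xr := congrArg Complex.re X
  have Xi := congrArg Complex.im X
  have Yr := congrArg Complex.re Y
  simp at Xr Xi Yr
  have n3 : ((u1 * u2 - v1 * v2) * u3 - (u1 * v2 + v1 * u2) * v3) ^ 2
      + ((u1 * u2 - v1 * v2) * v3 + (u1 * v2 + v1 * u2) * u3) ^ 2 = 1 := by
    have : ((u1 * u2 - v1 * v2) * u3 - (u1 * v2 + v1 * u2) * v3) ^ 2
      + ((u1 * u2 - v1 * v2) * v3 + (u1 * v2 + v1 * u2) * u3) ^ 2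
      = (u1 ^ 2 + v1 ^ 2) * (u2 ^ 2 + v2 ^ 2) * (u3 ^ 2 + v3 ^ 2) := by ring
    rw [this, h1, h2, h3]; norm_num
  set p := (u1 * u2 - v1 * v2) * u3 - (u1 * v2 + v1 * u2) * v3 with hp
  set q := (u1 * u2 - v1 * v2) * v3 + (u1 * v2 + v1 * u2) * u3 with hq
  have e2 : (u1 * u2 - v1 * v2) + (u1 * u3 - v1 * v3) + (u2 * u3 - v2 * v3)
      = p * (u1 + u2 + u3) + q * (v1 + v2 + v3) := by
    rw [hp, hq]
    linear_combination (-(u2 * u3 - v2 * v3)) * h1 - (u1 * u3 - v1 * v3) * h2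
      - (u1 * u2 - v1 * v2) * h3
  have Xr' : K * (u1 + u2 + u3) = - (c * p) := by linarith
  have Xi' : K * (v1 + v2 + v3) = - (c * q) := by linarith
  constructor
  · linear_combination (K * (u1 + u2 + u3) - c * p) * Xr' + (K * (v1 + v2 + v3) - c * q) * Xi'
      + c ^ 2 * n3
  · rw [e2] at Yr
    linear_combination (-K) * Yr + c * p * Xr' + c * q * Xi' - c ^ 2 * n3

lemma aux_sigma (u v x y : ℝ) (h1 : u ^ 2 + v ^ 2 = 1) (h2 : x ^ 2 + y ^ 2 = 1)
    (d : ¬ (u = x ∧ v = y)) : 0 < 1 - (u * x + v * y) := by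
  by_contra hc
  have e : (u - x) ^ 2 + (v - y) ^ 2 = 2 * (1 - (u * x + v * y)) := by
    linear_combination h1 + h2
  apply d
  constructor
  · nlinarith [sq_nonneg (u - x), sq_nonneg (v - y)]
  · nlinarith [sq_nonneg (u - x), sq_nonneg (v - y)]

lemma aux_chord (a b u v x y s m : ℝ) (h1 : u ^ 2 + v ^ 2 = 1) (h2 : x ^ 2 + y ^ 2 = 1)
    (d : 0 < 1 - (u * x + v * y)) (hs : s = m * (1 - (u * x + v * y)))
    (hs2 : s ^ 2 = (a * u - a * x) ^ 2 + (b * v - b * y) ^ 2) :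
    (a ^ 2 + b ^ 2 - m ^ 2) + m ^ 2 * (u * x + v * y)
      - (a ^ 2 - b ^ 2) * (u * x - v * y) = 0 := by
  have e1 : (u - x) ^ 2 = (1 - (u * x + v * y)) * (1 - (u * x - v * y)) := by
    linear_combination y ^ 2 * h1 + (1 - u ^ 2) * h2
  have e2 : (v - y) ^ 2 = (1 - (u * x + v * y)) * (1 + (u * x - v * y)) := by
    linear_combination x ^ 2 * h1 + (1 - v ^ 2) * h2
  apply mul_left_cancel₀ d.ne'
  rw [hs] at hs2
  linear_combination (-1) * hs2 - a ^ 2 * e1 - b ^ 2 * e2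

lemma aux_gram (u1 v1 u2 v2 u3 v3 : ℝ) (h1 : u1 ^ 2 + v1 ^ 2 = 1)
    (h2 : u2 ^ 2 + v2 ^ 2 = 1) (h3 : u3 ^ 2 + v3 ^ 2 = 1) :
    1 + 2 * (u1 * u2 + v1 * v2) * (u1 * u3 + v1 * v3) * (u2 * u3 + v2 * v3)
     - (u1 * u2 + v1 * v2) ^ 2 - (u1 * u3 + v1 * v3) ^ 2 - (u2 * u3 + v2 * v3) ^ 2 = 0 := by
  have : (u1 ^ 2 + v1 ^ 2) * (u2 ^ 2 + v2 ^ 2) * (u3 ^ 2 + v3 ^ 2)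
     + 2 * (u1 * u2 + v1 * v2) * (u1 * u3 + v1 * v3) * (u2 * u3 + v2 * v3)
     - (u3 ^ 2 + v3 ^ 2) * (u1 * u2 + v1 * v2) ^ 2 - (u2 ^ 2 + v2 ^ 2) * (u1 * u3 + v1 * v3) ^ 2
     - (u1 ^ 2 + v1 ^ 2) * (u2 * u3 + v2 * v3) ^ 2 = 0 := by ring
  rw [h1, h2, h3] at this
  linarith

lemma aux_det (u1 v1 u2 v2 u3 v3 : ℝ) (h1 : u1 ^ 2 + v1 ^ 2 = 1)
    (h2 : u2 ^ 2 + v2 ^ 2 = 1) (h3 : u3 ^ 2 + v3 ^ 2 = 1) :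
    ((u2 - u1) * (v3 - v1) - (v2 - v1) * (u3 - u1)) ^ 2 =
     2 * (1 - (u1 * u2 + v1 * v2)) * (1 - (u1 * u3 + v1 * v3)) * (1 - (u2 * u3 + v2 * v3)) := by
  have : - ((u2 - u1) * (v3 - v1) - (v2 - v1) * (u3 - u1)) ^ 2 =
     (u1 ^ 2 + v1 ^ 2 - 1) * (u2 ^ 2 + v2 ^ 2 - 1) * (u3 ^ 2 + v3 ^ 2 - 1)
     - 2 * (1 - (u1 * u2 + v1 * v2)) * (1 - (u1 * u3 + v1 * v3)) * (1 - (u2 * u3 + v2 * v3))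
     - (u3 ^ 2 + v3 ^ 2 - 1) * (1 - (u1 * u2 + v1 * v2)) ^ 2
     - (u2 ^ 2 + v2 ^ 2 - 1) * (1 - (u1 * u3 + v1 * v3)) ^ 2
     - (u1 ^ 2 + v1 ^ 2 - 1) * (1 - (u2 * u3 + v2 * v3)) ^ 2 := by ring
  rw [h1, h2, h3] at this
  linarith

/-- invariant ratio from unit circle coordinates -/
lemma aux_ratio (a b : ℝ) (hb : 0 < b) (hab : b < a) (u1 v1 u2 v2 u3 v3 s1 s2 s3 : ℝ)
    (h1 : u1 ^ 2 + v1 ^ 2 = 1) (h2 : u2 ^ 2 + v2 ^ 2 = 1) (h3 : u3 ^ 2 + v3 ^ 2 = 1)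
    (d12 : ¬ (u1 = u2 ∧ v1 = v2)) (d13 : ¬ (u1 = u3 ∧ v1 = v3)) (d23 : ¬ (u2 = u3 ∧ v2 = v3))
    (p1 : 0 < s1) (p2 : 0 < s2) (p3 : 0 < s3)
    (q1 : s1 ^ 2 = (a * u2 - a * u3) ^ 2 + (b * v2 - b * v3) ^ 2)
    (q2 : s2 ^ 2 = (a * u1 - a * u3) ^ 2 + (b * v1 - b * v3) ^ 2)
    (q3 : s3 ^ 2 = (a * u1 - a * u2) ^ 2 + (b * v1 - b * v2) ^ 2)
    (r1 : (1 - (u1 * u2 + v1 * v2)) * s2 = (1 - (u1 * u3 + v1 * v3)) * s3)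
    (r2 : (1 - (u2 * u3 + v2 * v3)) * s3 = (1 - (u1 * u2 + v1 * v2)) * s1) :
    (-s1 + s2 + s3) * (s1 - s2 + s3) * (s1 + s2 - s3) / (4 * s1 * s2 * s3) =
    (Real.sqrt (a ^ 4 - a ^ 2 * b ^ 2 + b ^ 4) - b ^ 2) *
      (a ^ 2 - Real.sqrt (a ^ 4 - a ^ 2 * b ^ 2 + b ^ 4)) / (a ^ 2 - b ^ 2) ^ 2 := by
  have t3 := aux_sigma _ _ _ _ h1 h2 d12
  have t2 := aux_sigma _ _ _ _ h1 h3 d13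
  have t1 := aux_sigma _ _ _ _ h2 h3 d23
  obtain ⟨m, hm⟩ : ∃ m, m = s3 / (1 - (u1 * u2 + v1 * v2)) := ⟨_, rfl⟩
  have mp : 0 < m := by rw [hm]; positivity
  have m3 : s3 = m * (1 - (u1 * u2 + v1 * v2)) := by rw [hm]; field_simp
  have m2 : s2 = m * (1 - (u1 * u3 + v1 * v3)) := by
    apply mul_left_cancel₀ t3.ne'
    rw [r1, m3]; ring
  have m1 : s1 = m * (1 - (u2 * u3 + v2 * v3)) := by
    apply mul_left_cancel₀ t3.ne'
    rw [← r2, m3]; ring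
  have f12 := aux_chord a b _ _ _ _ _ _ h1 h2 t3 m3 q3
  have f13 := aux_chord a b _ _ _ _ _ _ h1 h3 t2 m2 q2
  have f23 := aux_chord a b _ _ _ _ _ _ h2 h3 t1 m1 q1
  obtain ⟨C1, C2⟩ := aux_core _ _ _ _ _ _ _ _ _ h1 h2 h3 d12 d13 d23 f12 f13 f23
  have G := aux_gram _ _ _ _ _ _ h1 h2 h3
  have hS : (m ^ 2) ^ 2 * (9 - 2 * ((1 - (u1 * u2 + v1 * v2)) + (1 - (u1 * u3 + v1 * v3))
      + (1 - (u2 * u3 + v2 * v3)))) = (a ^ 2 - b ^ 2) ^ 2 := by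
    rw [← C1]
    linear_combination (-(m ^ 2) ^ 2) * (h1 + h2 + h3)
  rw [m1, m2, m3]
  generalize hc3 : u1 * u2 + v1 * v2 = c3 at *
  generalize hc2 : u1 * u3 + v1 * v3 = c2 at *
  generalize hc1 : u2 * u3 + v2 * v3 = c1 at *
  have hKp : 0 < m ^ 2 := by positivity
  generalize hK : m ^ 2 = K at *
  have L : (-(m * (1 - c1)) + m * (1 - c2) + m * (1 - c3)) * (m * (1 - c1) - m * (1 - c2) + m * (1 - c3)) *
      (m * (1 - c1) + m * (1 - c2) - m * (1 - c3)) /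
      (4 * (m * (1 - c1)) * (m * (1 - c2)) * (m * (1 - c3))) =
      (1 - c1 + (1 - c2) + (1 - c3)) / 2 - 2 := by
    rw [div_eq_iff (by positivity)]
    linear_combination (m ^ 3 * (1 - c1 + (1 - c2) + (1 - c3))) * G
  rw [L]
  have hpos : 0 < a ^ 2 - b ^ 2 := sub_pos.mpr (pow_lt_pow_left₀ hab hb.le two_ne_zero)
  obtain ⟨δ, hδ⟩ : ∃ δ, δ = Real.sqrt (a ^ 4 - a ^ 2 * b ^ 2 + b ^ 4) := ⟨_, rfl⟩
  rw [← hδ]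
  have δ0 : 0 ≤ δ := hδ ▸ Real.sqrt_nonneg _
  have δ2 : δ ^ 2 = a ^ 4 - a ^ 2 * b ^ 2 + b ^ 4 := by
    rw [hδ, Real.sq_sqrt]
    have e : a ^ 4 - a ^ 2 * b ^ 2 + b ^ 4 = (a ^ 2 - b ^ 2) ^ 2 + a ^ 2 * b ^ 2 := by ring
    rw [e]; positivity
  have hlt : (a ^ 2 + b ^ 2) < 2 * δ := by
    apply lt_of_pow_lt_pow_left₀ 2 (by positivity)
    have e : (2 * δ) ^ 2 = (a ^ 2 + b ^ 2) ^ 2 + 3 * (a ^ 2 - b ^ 2) ^ 2 := by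
      linear_combination 4 * δ2
    rw [e]
    have : 0 < 3 * (a ^ 2 - b ^ 2) ^ 2 := by positivity
    linarith
  have hKv : 3 * K = a ^ 2 + b ^ 2 + 2 * δ := by
    have : (3 * K - (a ^ 2 + b ^ 2 + 2 * δ)) * (3 * K - (a ^ 2 + b ^ 2) + 2 * δ) = 0 := by
      linear_combination (-3) * C2 - 4 * δ2
    rcases mul_eq_zero.mp this with h | h
    · linarith
    · linarith
  have hk : K * (2 * δ - a ^ 2 - b ^ 2) = (a ^ 2 - b ^ 2) ^ 2 := by
    linear_combination (2 * δ - a ^ 2 - b ^ 2) / 3 * hKv + 4 / 3 * δ2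
  have hS2 : (9 - 2 * ((1 - c3) + (1 - c2) + (1 - c1))) * (a ^ 2 - b ^ 2) ^ 2
      = (2 * δ - a ^ 2 - b ^ 2) ^ 2 := by
    apply mul_left_cancel₀ (pow_ne_zero 2 hKp.ne')
    linear_combination (a ^ 2 - b ^ 2) ^ 2 * hS
      - (K * (2 * δ - a ^ 2 - b ^ 2) + (a ^ 2 - b ^ 2) ^ 2) * hk
  rw [eq_div_iff (by positivity)]
  linear_combination (-1 / 4) * hS2

lemma aux_area (x1 y1 x2 y2 x3 y3 s1 s2 s3 : ℝ)
    (p1 : 0 < s1) (p2 : 0 < s2) (p3 : 0 < s3)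
    (q1 : s1 ^ 2 = (x2 - x3) ^ 2 + (y2 - y3) ^ 2)
    (q2 : s2 ^ 2 = (x1 - x3) ^ 2 + (y1 - y3) ^ 2)
    (q3 : s3 ^ 2 = (x1 - x2) ^ 2 + (y1 - y2) ^ 2)
    (hD : (x2 - x1) * (y3 - y1) - (y2 - y1) * (x3 - x1) ≠ 0)
    (e1 f1 e2 f2 e3 f3 : ℝ)
    (he1 : e1 = (-s1 + s2 + s3)⁻¹ * (-s1 * x1 + s2 * x2 + s3 * x3))
    (hf1 : f1 = (-s1 + s2 + s3)⁻¹ * (-s1 * y1 + s2 * y2 + s3 * y3))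
    (he2 : e2 = (s1 - s2 + s3)⁻¹ * (s1 * x1 + -s2 * x2 + s3 * x3))
    (hf2 : f2 = (s1 - s2 + s3)⁻¹ * (s1 * y1 + -s2 * y2 + s3 * y3))
    (he3 : e3 = (s1 + s2 - s3)⁻¹ * (s1 * x1 + s2 * x2 + -s3 * x3))
    (hf3 : f3 = (s1 + s2 - s3)⁻¹ * (s1 * y1 + s2 * y2 + -s3 * y3)) :
    (|(x2 - x1) * (y3 - y1) - (y2 - y1) * (x3 - x1)| / 2) /
    (|(e2 - e1) * (f3 - f1) - (f2 - f1) * (e3 - e1)| / 2) =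
    (-s1 + s2 + s3) * (s1 - s2 + s3) * (s1 + s2 - s3) / (4 * s1 * s2 * s3) := by
  have heron : (s1 + s2 + s3) * ((-s1 + s2 + s3) * (s1 - s2 + s3) * (s1 + s2 - s3))
      = 4 * ((x2 - x1) * (y3 - y1) - (y2 - y1) * (x3 - x1)) ^ 2 := by
    have : (s1 + s2 + s3) * ((-s1 + s2 + s3) * (s1 - s2 + s3) * (s1 + s2 - s3))
      = 2 * (s1 ^ 2 * s2 ^ 2 + s1 ^ 2 * s3 ^ 2 + s2 ^ 2 * s3 ^ 2)
        - (s1 ^ 2) ^ 2 - (s2 ^ 2) ^ 2 - (s3 ^ 2) ^ 2 := by ring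
    rw [this, q1, q2, q3]; ring
  have hpos : 0 < (-s1 + s2 + s3) * (s1 - s2 + s3) * (s1 + s2 - s3) := by
    have : 0 < (s1 + s2 + s3) * ((-s1 + s2 + s3) * (s1 - s2 + s3) * (s1 + s2 - s3)) := by
      rw [heron]; positivity
    exact (pos_iff_pos_of_mul_pos this).mp (by positivity)
  have n1 : -s1 + s2 + s3 ≠ 0 := by intro h; rw [h] at hpos; simp at hpos
  have n2 : s1 - s2 + s3 ≠ 0 := by intro h; rw [h] at hpos; simp at hpos
  have n3 : s1 + s2 - s3 ≠ 0 := by intro h; rw [h] at hpos; simp at hpos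
  have E : (e2 - e1) * (f3 - f1) - (f2 - f1) * (e3 - e1) =
     ((x2 - x1) * (y3 - y1) - (y2 - y1) * (x3 - x1)) *
      (4 * s1 * s2 * s3 / ((-s1 + s2 + s3) * (s1 - s2 + s3) * (s1 + s2 - s3))) := by
    rw [inv_mul_eq_div] at he1 hf1 he2 hf2 he3 hf3
    rw [eq_div_iff n1] at he1 hf1
    rw [eq_div_iff n2] at he2 hf2
    rw [eq_div_iff n3] at he3 hf3
    rw [mul_div_assoc', eq_div_iff hpos.ne']
    have a1 : (e2 - e1) * ((s1 - s2 + s3) * (-s1 + s2 + s3)) =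
      (s1 * x1 + -s2 * x2 + s3 * x3) * (-s1 + s2 + s3)
       - (-s1 * x1 + s2 * x2 + s3 * x3) * (s1 - s2 + s3) := by
      linear_combination (-s1 + s2 + s3) * he2 - (s1 - s2 + s3) * he1
    have a2 : (f2 - f1) * ((s1 - s2 + s3) * (-s1 + s2 + s3)) =
      (s1 * y1 + -s2 * y2 + s3 * y3) * (-s1 + s2 + s3)
       - (-s1 * y1 + s2 * y2 + s3 * y3) * (s1 - s2 + s3) := by
      linear_combination (-s1 + s2 + s3) * hf2 - (s1 - s2 + s3) * hf1
    have a3 : (e3 - e1) * ((s1 + s2 - s3) * (-s1 + s2 + s3)) =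
      (s1 * x1 + s2 * x2 + -s3 * x3) * (-s1 + s2 + s3)
       - (-s1 * x1 + s2 * x2 + s3 * x3) * (s1 + s2 - s3) := by
      linear_combination (-s1 + s2 + s3) * he3 - (s1 + s2 - s3) * he1
    have a4 : (f3 - f1) * ((s1 + s2 - s3) * (-s1 + s2 + s3)) =
      (s1 * y1 + s2 * y2 + -s3 * y3) * (-s1 + s2 + s3)
       - (-s1 * y1 + s2 * y2 + s3 * y3) * (s1 + s2 - s3) := by
      linear_combination (-s1 + s2 + s3) * hf3 - (s1 + s2 - s3) * hf1
    apply mul_left_cancel₀ n1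
    have : (-s1 + s2 + s3) * (((e2 - e1) * (f3 - f1) - (f2 - f1) * (e3 - e1)) *
       ((-s1 + s2 + s3) * (s1 - s2 + s3) * (s1 + s2 - s3))) =
       ((e2 - e1) * ((s1 - s2 + s3) * (-s1 + s2 + s3))) *
       ((f3 - f1) * ((s1 + s2 - s3) * (-s1 + s2 + s3))) -
       ((f2 - f1) * ((s1 - s2 + s3) * (-s1 + s2 + s3))) *
       ((e3 - e1) * ((s1 + s2 - s3) * (-s1 + s2 + s3))) := by ring
    rw [this, a1, a2, a3, a4]
    ring
  have hq : 0 < 4 * s1 * s2 * s3 / ((-s1 + s2 + s3) * (s1 - s2 + s3) * (s1 + s2 - s3)) := by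
    apply div_pos _ hpos
    positivity
  rw [E, abs_mul, abs_of_pos hq]
  have := abs_ne_zero.mpr hD
  generalize |(x2 - x1) * (y3 - y1) - (y2 - y1) * (x3 - x1)| = T at *
  generalize (-s1 + s2 + s3) * (s1 - s2 + s3) * (s1 + s2 - s3) = Z at *
  have := hpos.ne'
  field_simp

lemma aux_norm (P Q : Pt) (x y z w : ℝ) (h0 : P 0 = x) (h1 : P 1 = y) (h2 : Q 0 = z)
    (h3 : Q 1 = w) : ‖P - Q‖ ^ 2 = (x - z) ^ 2 + (y - w) ^ 2 := by
  rw [EuclideanSpace.norm_sq_eq]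
  simp [Fin.sum_univ_two, h0, h1, h2, h3]

lemma aux_reflects (a b : ℝ) (ha : 0 < a) (hb : 0 < b) (P Q R : Pt) (u v x y z w : ℝ)
    (hp0 : P 0 = a * u) (hp1 : P 1 = b * v) (hq0 : Q 0 = a * x) (hq1 : Q 1 = b * y)
    (hr0 : R 0 = a * z) (hr1 : R 1 = b * w) (h1 : u ^ 2 + v ^ 2 = 1)
    (dq : 0 < 1 - (u * x + v * y)) (dr : 0 < 1 - (u * z + v * w))
    (pq : 0 < ‖Q - P‖) (pr : 0 < ‖R - P‖)
    (h : reflects a b P Q R) :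
    (1 - (u * x + v * y)) * ‖R - P‖ = (1 - (u * z + v * w)) * ‖Q - P‖ := by
  unfold reflects at h
  have hq := aux_norm Q P _ _ _ _ hq0 hq1 hp0 hp1
  have hr := aux_norm R P _ _ _ _ hr0 hr1 hp0 hp1
  simp only [PiLp.add_apply, PiLp.smul_apply, PiLp.sub_apply, smul_eq_mul, hp0, hp1, hq0, hq1,
    hr0, hr1] at h
  have eq1 : (a * u / a ^ 2) * (a * x - a * u) + (b * v / b ^ 2) * (b * y - b * v)
      = -(1 - (u * x + v * y)) := by
    field_simp
    linear_combination (-1) * h1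
  have eq2 : (a * u / a ^ 2) * (a * z - a * u) + (b * v / b ^ 2) * (b * w - b * v)
      = -(1 - (u * z + v * w)) := by
    field_simp
    linear_combination (-1) * h1
  have := aux_refl (a * u / a ^ 2) (b * v / b ^ 2) _ _ _ _ _ _ pq pr hq hr
    (by rw [← h]; ring) (by rw [eq1]; linarith) (by rw [eq2]; linarith)
  rw [eq1, eq2] at this
  linarith

/-- The ratio of the orbit's area to the area of its excentral triangle is invariant. -/
theorem orbit_excentral_area_ratio (a b : ℝ) (hb : 0 < b) (hab : b < a)
    (P₁ P₂ P₃ : Pt) (h : IsOrbit a b P₁ P₂ P₃) :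
    let s₁ := ‖P₃ - P₂‖
    let s₂ := ‖P₁ - P₃‖
    let s₃ := ‖P₂ - P₁‖
    let A := |((P₂ - P₁) 0) * ((P₃ - P₁) 1) - ((P₂ - P₁) 1) * ((P₃ - P₁) 0)| / 2
    let E₁ : Pt := (-s₁ + s₂ + s₃)⁻¹ • ((-s₁) • P₁ + s₂ • P₂ + s₃ • P₃)
    let E₂ : Pt := (s₁ - s₂ + s₃)⁻¹ • (s₁ • P₁ + (-s₂) • P₂ + s₃ • P₃)
    let E₃ : Pt := (s₁ + s₂ - s₃)⁻¹ • (s₁ • P₁ + s₂ • P₂ + (-s₃) • P₃)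
    let A' := |((E₂ - E₁) 0) * ((E₃ - E₁) 1) - ((E₂ - E₁) 1) * ((E₃ - E₁) 0)| / 2
    let δ := Real.sqrt (a ^ 4 - a ^ 2 * b ^ 2 + b ^ 4)
    A / A' = (δ - b ^ 2) * (a ^ 2 - δ) / (a ^ 2 - b ^ 2) ^ 2 := by
  obtain ⟨n12, n23, n13, o1, o2, o3, g1, g2, g3⟩ := h
  have ha : 0 < a := hb.trans hab
  have coord : ∀ P : Pt, onEllipse a b P →
      ∃ u v : ℝ, P 0 = a * u ∧ P 1 = b * v ∧ u ^ 2 + v ^ 2 = 1 := by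
    intro P hP
    refine ⟨P 0 / a, P 1 / b, by field_simp, by field_simp, ?_⟩
    unfold onEllipse at hP
    rw [div_pow, div_pow]; exact hP
  obtain ⟨u1, v1, x1, y1, c1⟩ := coord P₁ o1
  obtain ⟨u2, v2, x2, y2, c2⟩ := coord P₂ o2
  obtain ⟨u3, v3, x3, y3, c3⟩ := coord P₃ o3
  have dist : ∀ (P Q : Pt) (u v x y : ℝ), P 0 = a * u → P 1 = b * v → Q 0 = a * x →
      Q 1 = b * y → P ≠ Q → ¬ (u = x ∧ v = y) := by
    rintro P Q u v x y h0 h1 h2 h3 hne ⟨rfl, rfl⟩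
    apply hne
    ext i
    fin_cases i
    · simp [h0, h2]
    · simp [h1, h3]
  have d12 := dist _ _ _ _ _ _ x1 y1 x2 y2 n12
  have d13 := dist _ _ _ _ _ _ x1 y1 x3 y3 n13
  have d23 := dist _ _ _ _ _ _ x2 y2 x3 y3 n23
  have t12 := aux_sigma _ _ _ _ c1 c2 d12
  have t13 := aux_sigma _ _ _ _ c1 c3 d13
  have t23 := aux_sigma _ _ _ _ c2 c3 d23
  have p1 : 0 < ‖P₃ - P₂‖ := norm_pos_iff.mpr (sub_ne_zero.mpr n23.symm)
  have p2 : 0 < ‖P₁ - P₃‖ := norm_pos_iff.mpr (sub_ne_zero.mpr n13)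
  have p3 : 0 < ‖P₂ - P₁‖ := norm_pos_iff.mpr (sub_ne_zero.mpr n12.symm)
  have q1 := aux_norm P₂ P₃ _ _ _ _ x2 y2 x3 y3
  have q2 := aux_norm P₁ P₃ _ _ _ _ x1 y1 x3 y3
  have q3 := aux_norm P₁ P₂ _ _ _ _ x1 y1 x2 y2
  have r1 := aux_reflects a b ha hb P₁ P₂ P₃ _ _ _ _ _ _ x1 y1 x2 y2 x3 y3 c1 t12 t13 p3
    (by rwa [norm_sub_rev]) g1
  have r2 := aux_reflects a b ha hb P₂ P₃ P₁ _ _ _ _ _ _ x2 y2 x3 y3 x1 y1 c2 t23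
    (by linarith) p1 (by rwa [norm_sub_rev]) g2
  rw [norm_sub_rev P₃ P₁] at r1
  rw [norm_sub_rev P₁ P₂, mul_comm u2 u1, mul_comm v2 v1] at r2
  rw [norm_sub_rev P₂ P₃] at q1
  rw [norm_sub_rev P₁ P₂] at q3
  intro s₁ s₂ s₃ A E₁ E₂ E₃ A' δ
  have hD : (a * u2 - a * u1) * (b * v3 - b * v1) - (b * v2 - b * v1) * (a * u3 - a * u1) ≠ 0 := by
    have e : (a * u2 - a * u1) * (b * v3 - b * v1) - (b * v2 - b * v1) * (a * u3 - a * u1)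
      = a * b * ((u2 - u1) * (v3 - v1) - (v2 - v1) * (u3 - u1)) := by ring
    rw [e]
    refine mul_ne_zero (by positivity) ?_
    intro h0
    have hh := aux_det _ _ _ _ _ _ c1 c2 c3
    rw [h0] at hh
    have : 0 < 2 * (1 - (u1 * u2 + v1 * v2)) * (1 - (u1 * u3 + v1 * v3))
      * (1 - (u2 * u3 + v2 * v3)) := by positivity
    rw [← hh] at this
    norm_num at this
  have M := aux_area (a * u1) (b * v1) (a * u2) (b * v2) (a * u3) (b * v3) s₁ s₂ s₃ p1 p2 p3
    q1 q2 q3 hD (E₁ 0) (E₁ 1) (E₂ 0) (E₂ 1) (E₃ 0) (E₃ 1)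
    (by simp [E₁, x1, x2, x3]; ring) (by simp [E₁, y1, y2, y3]; ring)
    (by simp [E₂, x1, x2, x3]; ring) (by simp [E₂, y1, y2, y3]; ring)
    (by simp [E₃, x1, x2, x3]; ring) (by simp [E₃, y1, y2, y3]; ring)
  rw [aux_ratio a b hb hab _ _ _ _ _ _ _ _ _ c1 c2 c3 d12 d13 d23 p1 p2 p3 q1 q2 q3 r1 r2] at M
  rw [← M]
  simp only [A, A', PiLp.sub_apply, x1, x2, x3, y1, y2, y3]
end
end

section
/- If a 3-periodic billiard orbit P₁P₂P₃ in the ellipse E has a vertex at the vertical vertex of the billiard, P₁ = (0, b), then its inradius and circumradius are r = a²(a² − δ)/(c²·b) and R = (b² + δ)/(2b). -/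
noncomputable section

open EuclideanGeometry Real

lemma nsq (P Q : Pt) : ‖P - Q‖ ^ 2 = (P 0 - Q 0) ^ 2 + (P 1 - Q 1) ^ 2 := by
  rw [EuclideanSpace.real_norm_sq_eq, Fin.sum_univ_two]
  simp

lemma key_y (a b t s y : ℝ) (hb : 0 < b) (hab : b < a) (_ht : 0 < t) (_hs : 0 < s)
    (hyb : y < b) (hyb' : -b ≤ y) (he : t ^ 2 * b ^ 2 = a ^ 2 * (b ^ 2 - y ^ 2))
    (hs2 : s ^ 2 = t ^ 2 + (b - y) ^ 2)
    (hr : (s + t) * y * a ^ 2 + (b - y) * t * b ^ 2 = 0) :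
    (a ^ 2 - b ^ 2) * y + a ^ 2 * b = b * Real.sqrt (a ^ 4 - a ^ 2 * b ^ 2 + b ^ 4) := by
  have ha : 0 < a := hb.trans hab
  have hc : 0 < a ^ 2 - b ^ 2 := by nlinarith
  have h1 : s ^ 2 * y ^ 2 * a ^ 4 = t ^ 2 * ((a ^ 2 - b ^ 2) * y + b ^ 3) ^ 2 := by
    have : s * y * a ^ 2 = -t * ((a ^ 2 - b ^ 2) * y + b ^ 3) := by linear_combination hr
    linear_combination (s * y * a ^ 2 - t * ((a ^ 2 - b ^ 2) * y + b ^ 3)) * this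
  have h2 : a ^ 2 * (b - y) ^ 2 * b ^ 2 *
      ((a ^ 2 - b ^ 2) * y ^ 2 + 2 * a ^ 2 * b * y + b ^ 4) = 0 := by
    rw [hs2] at h1
    linear_combination (-b ^ 2) * h1 + (y ^ 2 * a ^ 4 - ((a ^ 2 - b ^ 2) * y + b ^ 3) ^ 2) * he
  have h3 : (a ^ 2 - b ^ 2) * y ^ 2 + 2 * a ^ 2 * b * y + b ^ 4 = 0 := by
    have : 0 < b - y := by linarith
    have h : a ^ 2 * (b - y) ^ 2 * b ^ 2 ≠ 0 := by positivity
    exact (mul_eq_zero.mp h2).resolve_left h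
  have h4 : 0 ≤ (a ^ 2 - b ^ 2) * y + a ^ 2 * b := by
    have := mul_le_mul_of_nonneg_left hyb' hc.le
    have : 0 < b ^ 3 := by positivity
    nlinarith
  have hd : 0 ≤ a ^ 4 - a ^ 2 * b ^ 2 + b ^ 4 := by nlinarith [sq_nonneg (a ^ 2 - b ^ 2), sq_nonneg (a*b)]
  have h5 : ((a ^ 2 - b ^ 2) * y + a ^ 2 * b) ^ 2 =
      (b * Real.sqrt (a ^ 4 - a ^ 2 * b ^ 2 + b ^ 4)) ^ 2 := by
    rw [mul_pow, Real.sq_sqrt hd]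
    linear_combination (a ^ 2 - b ^ 2) * h3
  exact (pow_left_inj₀ h4 (by positivity) two_ne_zero).mp h5

/-- Inradius and circumradius of the orbit with a vertex at the vertical
billiard vertex (0, b). -/
theorem radii_at_vertical_vertex (a b : ℝ) (hb : 0 < b) (hab : b < a)
    (P₁ P₂ P₃ : Pt) (h : IsOrbit a b P₁ P₂ P₃)
    (hx : P₁ 0 = 0) (hy : P₁ 1 = b) :
    let s₁ := ‖P₃ - P₂‖
    let s₂ := ‖P₁ - P₃‖
    let s₃ := ‖P₂ - P₁‖
    let L := s₁ + s₂ + s₃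
    let A := |((P₂ - P₁) 0) * ((P₃ - P₁) 1) - ((P₂ - P₁) 1) * ((P₃ - P₁) 0)| / 2
    let r := 2 * A / L
    let R := s₁ * s₂ * s₃ / (4 * A)
    let δ := Real.sqrt (a ^ 4 - a ^ 2 * b ^ 2 + b ^ 4)
    r = a ^ 2 * (a ^ 2 - δ) / ((a ^ 2 - b ^ 2) * b) ∧ R = (b ^ 2 + δ) / (2 * b) := by
  have ha : 0 < a := hb.trans hab
  have hc : 0 < a ^ 2 - b ^ 2 := by nlinarith
  obtain ⟨h12, h23, h13, -, e2, e3, r1, r2, -⟩ := h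
  have n12 := nsq P₂ P₁
  have n13 := nsq P₃ P₁
  have n32 := nsq P₃ P₂
  have p12 : 0 < ‖P₂ - P₁‖ := norm_pos_iff.mpr (sub_ne_zero.mpr h12.symm)
  have p13 : 0 < ‖P₃ - P₁‖ := norm_pos_iff.mpr (sub_ne_zero.mpr h13.symm)
  have p32 : 0 < ‖P₃ - P₂‖ := norm_pos_iff.mpr (sub_ne_zero.mpr h23.symm)
  have ext2 : ∀ P Q : Pt, P 0 = Q 0 → P 1 = Q 1 → P = Q := by
    intro P Q h0 h1
    ext i
    fin_cases i
    · exact h0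
    · exact h1
  have d12 : P₂ 0 = 0 → P₂ 1 = b → False := fun h0 h1 =>
    h12 (ext2 _ _ (by rw [hx, h0]) (by rw [hy, h1]))
  have d13 : P₃ 0 = 0 → P₃ 1 = b → False := fun h0 h1 =>
    h13 (ext2 _ _ (by rw [hx, h0]) (by rw [hy, h1]))
  have d23 := ext2 P₂ P₃
  unfold reflects at r1 r2
  unfold onEllipse at e2 e3
  simp only [PiLp.add_apply, PiLp.smul_apply, PiLp.sub_apply, smul_eq_mul] at r1 r2
  intro s₁ s₂ s₃ L A r R δ
  have hs2 : s₂ = ‖P₃ - P₁‖ := norm_sub_rev _ _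
  have hA : A = |(P₂ 0 - P₁ 0) * (P₃ 1 - P₁ 1) - (P₂ 1 - P₁ 1) * (P₃ 0 - P₁ 0)| / 2 := by
    simp [A]
  rw [norm_sub_rev P₁ P₂] at r2
  change 0 < s₃ at p12
  change s₃ ^ 2 = _ at n12
  change 0 < s₁ at p32
  change s₁ ^ 2 = _ at n32
  rw [← hs2] at p13 n13 r1
  change (s₃⁻¹ * _ + _) * _ + (s₃⁻¹ * _ + _) * _ = 0 at r1
  change (s₁⁻¹ * _ + s₃⁻¹ * _) * _ + (s₁⁻¹ * _ + s₃⁻¹ * _) * _ = 0 at r2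
  simp only [r, R, L, hA]
  have hδ : δ = Real.sqrt (a ^ 4 - a ^ 2 * b ^ 2 + b ^ 4) := rfl
  clear_value s₁ s₂ s₃ δ
  rw [hx, hy] at *
  generalize P₂ 0 = x at *
  generalize P₂ 1 = y at *
  generalize P₃ 0 = u at *
  generalize P₃ 1 = v at *
  have e2' : x ^ 2 * b ^ 2 = a ^ 2 * (b ^ 2 - y ^ 2) := by
    field_simp at e2
    linear_combination e2
  have e3' : u ^ 2 * b ^ 2 = a ^ 2 * (b ^ 2 - v ^ 2) := by
    field_simp at e3
    linear_combination e3
  have bound : ∀ x y : ℝ, x ^ 2 * b ^ 2 = a ^ 2 * (b ^ 2 - y ^ 2) → (x = 0 → y = b → False) →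
      y < b ∧ -b ≤ y := by
    intro x y e d
    have h0 : 0 ≤ b ^ 2 - y ^ 2 := by
      have : 0 ≤ a ^ 2 * (b ^ 2 - y ^ 2) := by rw [← e]; positivity
      exact nonneg_of_mul_nonneg_right this (by positivity)
    have h1 := abs_le_of_sq_le_sq' (by linarith : y ^ 2 ≤ b ^ 2) hb.le
    refine ⟨lt_of_le_of_ne h1.2 ?_, h1.1⟩
    intro hyb
    refine d ?_ hyb
    rw [hyb] at e
    have : x ^ 2 * b ^ 2 = 0 := by rw [e]; ring
    have hb2 : b ^ 2 ≠ 0 := by positivity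
    exact pow_eq_zero_iff two_ne_zero |>.mp ((mul_eq_zero.mp this).resolve_right hb2)
  obtain ⟨hyb, hyb'⟩ := bound x y e2' d12
  obtain ⟨hvb, hvb'⟩ := bound u v e3' d13
  have r1' : x * s₂ + u * s₃ = 0 := by
    field_simp at r1
    have ha2 : a ^ 2 ≠ 0 := by positivity
    apply mul_left_cancel₀ ha2
    linear_combination -r1
  have hq : a ^ 2 * ((b - v) * (b - y) * (2 * b * (y - v))) = 0 := by
    have : x ^ 2 * s₂ ^ 2 = u ^ 2 * s₃ ^ 2 := by
      linear_combination (x * s₂ - u * s₃) * r1'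
    rw [n12, n13] at this
    linear_combination b ^ 2 * this - (v - b) ^ 2 * e2' + (y - b) ^ 2 * e3'
  have hvy : v = y := by
    have h1 : 0 < b - v := by linarith
    have h2 : 0 < b - y := by linarith
    have h3 : a ^ 2 * ((b - v) * (b - y) * (2 * b)) ≠ 0 := by positivity
    have h4 : a ^ 2 * ((b - v) * (b - y) * (2 * b)) * (y - v) = 0 := by linear_combination hq
    have := (mul_eq_zero.mp h4).resolve_left h3
    linarith
  subst hvy
  have hxu : x ≠ u := fun h => h23 (d23 h rfl)
  have hux : u = -x := by
    have h1 : (u - x) * (u + x) = 0 := by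
      have hb2 : b ^ 2 ≠ 0 := by positivity
      have : b ^ 2 * ((u - x) * (u + x)) = 0 := by linear_combination e3' - e2'
      exact (mul_eq_zero.mp this).resolve_left hb2
    have := (mul_eq_zero.mp h1).resolve_left (sub_ne_zero.mpr hxu.symm)
    linarith
  subst hux
  have hx0 : x ≠ 0 := by
    intro h
    exact hxu (by rw [h]; simp)
  have ht : 0 < |x| := abs_pos.mpr hx0
  have hss : s₂ = s₃ := (pow_left_inj₀ p13.le p12.le two_ne_zero).mp (by rw [n12, n13]; ring)
  have hs1 : s₁ = 2 * |x| := (pow_left_inj₀ p32.le (by positivity) two_ne_zero).mp (by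
    rw [n32, mul_pow, sq_abs]; ring)
  have habs : |(x - 0) * (v - b) - (v - b) * (-x - 0)| = 2 * |x| * (b - v) := by
    rw [show (x - 0) * (v - b) - (v - b) * (-x - 0) = -(2 * x * (b - v)) by ring, abs_neg,
      abs_mul, abs_mul, abs_of_pos (by linarith : 0 < b - v)]
    simp
  have hbv : 0 < b - v := by linarith
  have hr : (s₃ + |x|) * v * a ^ 2 + (b - v) * |x| * b ^ 2 = 0 := by
    rw [hs1] at r2
    have hxx : x * x = |x| * |x| := (abs_mul_abs_self x).symm
    field_simp at r2
    have : x * ((s₃ + |x|) * v * a ^ 2 + (b - v) * |x| * b ^ 2) = 0 := by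
      linear_combination (1 / 2) * r2
    exact (mul_eq_zero.mp this).resolve_left hx0
  have hk := key_y a b |x| s₃ v hb hab ht p12 hyb hyb' (by rw [sq_abs]; exact e2')
    (by rw [sq_abs, n12]; ring) hr
  rw [← hδ] at hk
  rw [habs, hss, hs1]
  have n12' : s₃ ^ 2 * b ^ 2 = (b - v) * (a ^ 2 * (b + v) + b ^ 2 * (b - v)) := by
    rw [n12]; linear_combination e2'
  constructor
  · rw [div_eq_div_iff (by positivity) (by positivity)]
    have hb2 : b ^ 1 ≠ 0 := by positivity
    apply mul_left_cancel₀ hb2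
    linear_combination (2 * (a ^ 2 - b ^ 2)) * hr - 2 * a ^ 2 * (|x| + s₃) * hk
  · rw [div_eq_div_iff (by positivity) (by positivity)]
    have hb2 : b ≠ 0 := by positivity
    apply mul_left_cancel₀ hb2
    linear_combination 4 * |x| * n12' + 4 * |x| * (b - v) * hk
end
end
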